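/- arXiv:1510.02939 — 3 statements merged into one kernel-verified Lean document; each statement's English description precedes it below -/
import Mathlib

section
/- Consider scalings K_n, P_n, α_n such that α_n(1 − q(θ_n)) = (log n + γ_n)/n for all n, for some real sequence γ_n. If lim_{n→∞} γ_n = ∞, then lim_{n→∞} P_n(θ_n, α_n) = 1, i.e., with probability tending to one the random graph K∩G(n; θ_n, α_n) contains no isolated nodes. -/
open Filter Finset

noncomputable section

/-- Key rings: `K`-element subsets of a pool `{1,…,P}` of keys. -/
abbrev KeyRing (P K : ℕ) : Type := {S : Finset (Fin P) // S.card = K}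

/-- Unordered node pairs, represented as ordered pairs `(i,j)` with `i < j`. -/
abbrev Pairs (n : ℕ) : Type := {e : Fin n × Fin n // e.1 < e.2}

/-- The number `C(P,K)` of possible key rings. -/
def numKR (P K : ℕ) : ℝ := (P.choose K : ℝ)

/-- Probability weight of a configuration `(κ, b)` under the product of the uniform
distribution on key rings (i.i.d. over the `n` nodes) and i.i.d. Bernoulli(α)
on/off link variables (one per unordered pair of nodes). -/
def wt (n P K : ℕ) (α : ℝ) (κ : Fin n → KeyRing P K) (b : Pairs n → Bool) : ℝ :=
  (numKR P K)⁻¹ ^ n * ∏ e : Pairs n, (if b e then α else 1 - α)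

/-- The on/off state of the channel between nodes `i` and `j`. -/
def link {n : ℕ} (b : Pairs n → Bool) (i j : Fin n) : Bool :=
  if h : i < j then b ⟨(i, j), h⟩
  else if h' : j < i then b ⟨(j, i), h'⟩
  else false

/-- Adjacency in the intersection graph `K ∩ G(n; θ, α)`:  the key rings of `i` and `j`
intersect and the channel between them is on. -/
abbrev Adj {n P K : ℕ} (κ : Fin n → KeyRing P K) (b : Pairs n → Bool) (i j : Fin n) : Prop :=
  i ≠ j ∧ ((κ i).1 ∩ (κ j).1).Nonempty ∧ link b i j = true

/-- Node `i` is isolated: it is adjacent to no other node. -/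
abbrev Isolated {n P K : ℕ} (κ : Fin n → KeyRing P K) (b : Pairs n → Bool) (i : Fin n) : Prop :=
  ∀ j, ¬ Adj κ b i j

/-- `P_n(θ,α)`: probability that `K ∩ G(n; θ, α)` contains no isolated nodes. -/
def probNoIsolated (n P K : ℕ) (α : ℝ) : ℝ :=
  ∑ κ : Fin n → KeyRing P K, ∑ b : Pairs n → Bool,
    wt n P K α κ b * (if ∀ i, ¬ Isolated κ b i then 1 else 0)

/-- Number of isolated nodes in the configuration `(κ, b)`. -/
def numIsolated {n P K : ℕ} (κ : Fin n → KeyRing P K) (b : Pairs n → Bool) : ℕ :=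
  (Finset.univ.filter fun i => Isolated κ b i).card

/-- `E[I_n(θ,α)]`: expected number of isolated nodes in `K ∩ G(n; θ, α)`. -/
def expIsolated (n P K : ℕ) (α : ℝ) : ℝ :=
  ∑ κ : Fin n → KeyRing P K, ∑ b : Pairs n → Bool,
    wt n P K α κ b * (numIsolated κ b : ℝ)

/-- `q(θ) = C(P−K,K)/C(P,K)` if `2K ≤ P`, and `0` otherwise. -/
def q (K P : ℕ) : ℝ :=
  if 2 * K ≤ P then ((P - K).choose K : ℝ) / (P.choose K : ℝ) else 0

/-- `v(θ;r) = C(P−r,K)/C(P,K)` if `r ≤ P−K`, and `0` otherwise. -/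
def v (K P r : ℕ) : ℝ :=
  if r ≤ P - K then ((P - r).choose K : ℝ) / (P.choose K : ℝ) else 0

end

lemma aux_sum_b (n : ℕ) (α : ℝ) (E : Pairs n → Prop) [DecidablePred E] :
    ∑ b : Pairs n → Bool, (∏ e : Pairs n, (if b e then α else 1 - α)) *
      (if ∀ e, ¬ (E e ∧ b e = true) then 1 else 0)
      = ∏ e : Pairs n, (if E e then 1 - α else 1) := by
  classical
  have h : ∀ b : Pairs n → Bool, (∏ e : Pairs n, (if b e then α else 1 - α)) *
      (if ∀ e, ¬ (E e ∧ b e = true) then 1 else 0)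
      = ∏ e : Pairs n, ((if b e then α else 1 - α) * (if ¬ (E e ∧ b e = true) then 1 else 0)) := by
    intro b
    rw [Finset.prod_mul_distrib, Finset.prod_ite_zero]
    simp
  rw [Finset.sum_congr rfl (fun b _ => h b)]
  have h2 := Fintype.prod_sum (fun (e : Pairs n) (x : Bool) =>
    ((if x then α else 1 - α) * (if ¬ (E e ∧ x = true) then (1:ℝ) else 0)))
  rw [← h2]
  refine Finset.prod_congr rfl fun e _ => ?_
  by_cases he : E e <;> simp [he]

lemma aux_isolated {n P K : ℕ} (κ : Fin n → KeyRing P K) (b : Pairs n → Bool) (i : Fin n) :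
    Isolated κ b i ↔ ∀ e : Pairs n, ¬ (((e.1.1 = i ∨ e.1.2 = i) ∧
      ((κ e.1.1).1 ∩ (κ e.1.2).1).Nonempty) ∧ b e = true) := by
  constructor
  · rintro h ⟨⟨a, c⟩, hac⟩ ⟨⟨h1 | h1, h2⟩, h3⟩
    · simp only at h1 h2 hac
      subst h1
      exact h c ⟨hac.ne, h2, by simp [link, hac, h3]⟩
    · simp only at h1 h2 hac
      subst h1
      refine h a ⟨hac.ne', by rwa [Finset.inter_comm], ?_⟩
      simp [link, hac, h3, hac.le, hac.not_gt]
  · rintro h j ⟨hij, h2, h3⟩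
    rcases lt_or_gt_of_ne hij with hlt | hlt
    · exact h ⟨(i, j), hlt⟩ ⟨⟨Or.inl rfl, h2⟩, by simpa [link, hlt] using h3⟩
    · exact h ⟨(j, i), hlt⟩ ⟨⟨Or.inr rfl, by rwa [Finset.inter_comm]⟩, by
        simpa [link, hlt, hlt.not_gt] using h3⟩

lemma aux_reindex {n : ℕ} (i : Fin n) (R : Fin n → Fin n → Prop)
    [DecidableRel R] (hR : ∀ a b, R a b ↔ R b a) (α : ℝ) :
    ∏ e : Pairs n, (if (e.1.1 = i ∨ e.1.2 = i) ∧ R e.1.1 e.1.2 then 1 - α else 1)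
      = ∏ j ∈ univ.erase i, (if R i j then 1 - α else 1) := by
  have h : ∀ e : Pairs n, (if (e.1.1 = i ∨ e.1.2 = i) ∧ R e.1.1 e.1.2 then 1 - α else 1)
      = if (e.1.1 = i ∨ e.1.2 = i) then (if R e.1.1 e.1.2 then 1 - α else 1) else 1 := by
    intro e
    rw [ite_and]
  rw [Finset.prod_congr rfl (fun e _ => h e), ← Finset.prod_filter]
  refine Finset.prod_bij (fun e _ => if e.1.1 = i then e.1.2 else e.1.1) ?_ ?_ ?_ ?_
  · rintro ⟨⟨a, c⟩, hac⟩ he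
    simp at he hac ⊢
    split_ifs with h1
    · subst h1; exact hac.ne'
    · exact h1
  · rintro ⟨⟨a, c⟩, hac⟩ he ⟨⟨a', c'⟩, hac'⟩ he' heq
    simp at he he' hac hac' heq ⊢
    split_ifs at heq <;> grind
  · intro j hj
    simp at hj
    rcases lt_or_gt_of_ne hj with hlt | hlt
    · exact ⟨⟨(j, i), hlt⟩, by simp, by simp [hj]⟩
    · exact ⟨⟨(i, j), hlt⟩, by simp, by simp⟩
  · rintro ⟨⟨a, c⟩, hac⟩ he
    simp at he hac ⊢
    split_ifs with h1 h2 h3 h4 h5 <;> grind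

lemma aux_card (P K : ℕ) : (Fintype.card (KeyRing P K) : ℝ) = numKR P K := by
  simp [numKR, KeyRing]

lemma aux_q (P K : ℕ) (hKP : K < P) : q K P * numKR P K = ((P - K).choose K : ℝ) := by
  have : (P.choose K : ℝ) ≠ 0 := by
    exact_mod_cast (Nat.choose_pos hKP.le).ne'
  unfold q numKR
  split_ifs with h
  · field_simp
  · rw [Nat.choose_eq_zero_of_lt (show P - K < K by omega)]; simp

lemma aux_disj (P K : ℕ) (S : KeyRing P K) :
    (univ.filter fun x : KeyRing P K => ¬ (S.1 ∩ x.1).Nonempty).card = (P - K).choose K := by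
  classical
  have : (univ.filter fun x : KeyRing P K => ¬ (S.1 ∩ x.1).Nonempty).card
      = (Finset.powersetCard K (S.1ᶜ)).card := by
    refine Finset.card_bij (fun x _ => x.1) ?_ ?_ ?_
    · intro x hx
      simp only [Finset.mem_filter, Finset.not_nonempty_iff_eq_empty] at hx
      rw [Finset.mem_powersetCard]
      refine ⟨?_, x.2⟩
      intro y hy
      rw [Finset.mem_compl]
      intro hy'
      have : y ∈ S.1 ∩ x.1 := Finset.mem_inter.2 ⟨hy', hy⟩
      rw [hx.2] at this
      simp at this
    · intro a _ b _ h
      exact Subtype.ext h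
    · intro T hT
      rw [Finset.mem_powersetCard] at hT
      refine ⟨⟨T, hT.2⟩, ?_, rfl⟩
      simp only [Finset.mem_filter, Finset.mem_univ, true_and]
      rintro ⟨y, hy⟩
      rw [Finset.mem_inter] at hy
      exact (Finset.mem_compl.1 (hT.1 hy.2)) hy.1
  rw [this, Finset.card_powersetCard, Finset.card_compl, S.2, Fintype.card_fin]

lemma aux_sum_x (P K : ℕ) (hKP : K < P) (α : ℝ) (S : KeyRing P K) :
    ∑ x : KeyRing P K, (if (S.1 ∩ x.1).Nonempty then 1 - α else 1)
      = numKR P K * (1 - α * (1 - q K P)) := by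
  have h : ∀ x : KeyRing P K, (if (S.1 ∩ x.1).Nonempty then 1 - α else 1)
      = (1 - α) + α * (if ¬ (S.1 ∩ x.1).Nonempty then 1 else 0) := by
    intro x
    split_ifs <;> simp
  rw [Finset.sum_congr rfl (fun x _ => h x), Finset.sum_add_distrib, ← Finset.mul_sum,
    Finset.sum_boole, aux_disj, ← aux_q P K hKP]
  simp only [Finset.sum_const, Finset.card_univ, nsmul_eq_mul, aux_card]
  ring

lemma aux_sum_kappa {n : ℕ} {X : Type*} [Fintype X] [DecidableEq X] (i : Fin n)
    (h : X → X → ℝ) (c : ℝ) (hc : ∀ S, ∑ x, h S x = c) :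
    ∑ κ : Fin n → X, ∏ j ∈ univ.erase i, h (κ i) (κ j)
      = (Fintype.card X : ℝ) * c ^ (n - 1) := by
  have h1 : ∀ κ : Fin n → X, ∏ j ∈ univ.erase i, h (κ i) (κ j)
      = ∑ S : X, ∏ j : Fin n, (if j = i then (if κ j = S then 1 else 0) else h S (κ j)) := by
    intro κ
    have : ∀ S : X, ∏ j : Fin n, (if j = i then (if κ j = S then 1 else 0) else h S (κ j))
        = if κ i = S then ∏ j ∈ univ.erase i, h S (κ j) else 0 := by
      intro S
      rw [← Finset.mul_prod_erase univ _ (Finset.mem_univ i)]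
      rw [Finset.prod_congr rfl (g := fun j => h S (κ j))
        (fun j hj => by simp [Finset.ne_of_mem_erase hj])]
      simp
    rw [Finset.sum_congr rfl (fun S _ => this S)]
    simp
  rw [Finset.sum_congr rfl (fun κ _ => h1 κ), Finset.sum_comm]
  have h2 : ∀ S : X, ∑ κ : Fin n → X,
      ∏ j : Fin n, (if j = i then (if κ j = S then 1 else 0) else h S (κ j)) = c ^ (n - 1) := by
    intro S
    have := Fintype.prod_sum (fun (j : Fin n) (x : X) =>
      (if j = i then (if x = S then (1:ℝ) else 0) else h S x))
    rw [← this, ← Finset.mul_prod_erase univ _ (Finset.mem_univ i)]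
    rw [Finset.prod_congr rfl (g := fun _ => c)
        (fun j hj => by simp [Finset.ne_of_mem_erase hj, hc])]
    simp
  rw [Finset.sum_congr rfl (fun S _ => h2 S)]
  simp

lemma aux_numKR_pos (P K : ℕ) (hKP : K < P) : 0 < numKR P K := by
  unfold numKR
  exact_mod_cast Nat.choose_pos hKP.le

/-- The probability that a given node is isolated. -/
lemma aux_prob_isolated (n P K : ℕ) (hKP : K < P) (α : ℝ) (i : Fin n) :
    ∑ κ : Fin n → KeyRing P K, ∑ b : Pairs n → Bool,
      wt n P K α κ b * (if Isolated κ b i then 1 else 0) = (1 - α * (1 - q K P)) ^ (n - 1) := by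
  classical
  have h1 : ∀ κ : Fin n → KeyRing P K, ∑ b : Pairs n → Bool,
      wt n P K α κ b * (if Isolated κ b i then 1 else 0)
      = (numKR P K)⁻¹ ^ n * ∏ j ∈ univ.erase i,
          (if ((κ i).1 ∩ (κ j).1).Nonempty then 1 - α else 1) := by
    intro κ
    rw [← aux_reindex i (fun a c => ((κ a).1 ∩ (κ c).1).Nonempty)
      (fun a c => by rw [Finset.inter_comm]) α, ← aux_sum_b, Finset.mul_sum]
    refine Finset.sum_congr rfl fun b _ => ?_
    unfold wt
    rw [mul_assoc]
    congr 2
    exact if_congr (aux_isolated κ b i) rfl rfl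
  rw [Finset.sum_congr rfl (fun κ _ => h1 κ), ← Finset.mul_sum,
    aux_sum_kappa i (fun S x : KeyRing P K => if (S.1 ∩ x.1).Nonempty then 1 - α else 1)
      _ (aux_sum_x P K hKP α), aux_card, mul_pow]
  have hpos := aux_numKR_pos P K hKP
  have hn : n = (n - 1) + 1 := by have := i.pos; omega
  have : (numKR P K)⁻¹ ^ n * (numKR P K * numKR P K ^ (n - 1)) = 1 := by
    rw [← pow_succ', ← hn, ← mul_pow, inv_mul_cancel₀ hpos.ne', one_pow]
  calc _ = ((numKR P K)⁻¹ ^ n * (numKR P K * numKR P K ^ (n - 1))) *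
        (1 - α * (1 - q K P)) ^ (n - 1) := by ring
    _ = _ := by rw [this, one_mul]

lemma aux_total (n P K : ℕ) (hKP : K < P) (α : ℝ) :
    ∑ κ : Fin n → KeyRing P K, ∑ b : Pairs n → Bool, wt n P K α κ b = 1 := by
  classical
  have h1 : ∀ κ : Fin n → KeyRing P K, ∑ b : Pairs n → Bool, wt n P K α κ b
      = (numKR P K)⁻¹ ^ n := by
    intro κ
    have := aux_sum_b n α (fun _ => False)
    simp at this
    unfold wt
    rw [← Finset.mul_sum, this, mul_one]
  rw [Finset.sum_congr rfl (fun κ _ => h1 κ), Finset.sum_const, Finset.card_univ,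
    Fintype.card_fun, nsmul_eq_mul, Nat.cast_pow, aux_card, Fintype.card_fin, ← mul_pow,
    mul_inv_cancel₀ (aux_numKR_pos P K hKP).ne', one_pow]

lemma aux_wt_nonneg (n P K : ℕ) (hKP : K < P) (α : ℝ) (h0 : 0 ≤ α) (h1 : α ≤ 1)
    (κ : Fin n → KeyRing P K) (b : Pairs n → Bool) : 0 ≤ wt n P K α κ b := by
  unfold wt
  refine mul_nonneg (pow_nonneg (inv_nonneg.2 (aux_numKR_pos P K hKP).le) _)
    (Finset.prod_nonneg fun e _ => ?_)
  split_ifs <;> linarith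

lemma aux_le_one (n P K : ℕ) (hKP : K < P) (α : ℝ) (h0 : 0 ≤ α) (h1 : α ≤ 1) :
    probNoIsolated n P K α ≤ 1 := by
  rw [← aux_total n P K hKP α]
  refine Finset.sum_le_sum fun κ _ => Finset.sum_le_sum fun b _ => ?_
  have := aux_wt_nonneg n P K hKP α h0 h1 κ b
  split_ifs <;> linarith

lemma aux_ge (n P K : ℕ) (hKP : K < P) (α : ℝ) (h0 : 0 ≤ α) (h1 : α ≤ 1) :
    1 - n * (1 - α * (1 - q K P)) ^ (n - 1) ≤ probNoIsolated n P K α := by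
  have hs : (n : ℝ) * (1 - α * (1 - q K P)) ^ (n - 1) = ∑ κ : Fin n → KeyRing P K,
      ∑ b : Pairs n → Bool, ∑ i : Fin n, wt n P K α κ b * (if Isolated κ b i then 1 else 0) := by
    have : ∀ κ : Fin n → KeyRing P K,
      ∑ b : Pairs n → Bool, ∑ i : Fin n, wt n P K α κ b * (if Isolated κ b i then 1 else 0)
      = ∑ i : Fin n, ∑ b : Pairs n → Bool, wt n P K α κ b * (if Isolated κ b i then 1 else 0) :=
      fun κ => Finset.sum_comm
    rw [Finset.sum_congr rfl (fun κ _ => this κ), Finset.sum_comm,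
      Finset.sum_congr rfl (fun i _ => aux_prob_isolated n P K hKP α i)]
    simp
  have ht := aux_total n P K hKP α
  rw [hs]
  refine le_trans (sub_le_sub_right ht.ge _) ?_
  rw [← Finset.sum_sub_distrib]
  refine Finset.sum_le_sum fun κ _ => ?_
  rw [← Finset.sum_sub_distrib]
  refine Finset.sum_le_sum fun b _ => ?_
  have hw := aux_wt_nonneg n P K hKP α h0 h1 κ b
  have hnn : ∀ i ∈ (univ : Finset (Fin n)),
      0 ≤ wt n P K α κ b * (if Isolated κ b i then (1:ℝ) else 0) := by
    intro i _
    split_ifs <;> linarith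
  by_cases hall : ∀ i, ¬ Isolated κ b i
  · rw [if_pos hall]
    have := Finset.sum_nonneg hnn
    linarith
  · rw [if_neg hall]
    obtain ⟨i, hi'⟩ := not_forall.1 hall
    have hi : Isolated κ b i := not_not.1 hi'
    have := Finset.single_le_sum hnn (Finset.mem_univ i)
    rw [if_pos hi] at this
    linarith

lemma aux_q_le (P K : ℕ) (hKP : K < P) : 0 ≤ q K P ∧ q K P ≤ 1 := by
  have hpos := aux_numKR_pos P K hKP
  have h := aux_q P K hKP
  have h1 : ((P - K).choose K : ℝ) ≤ numKR P K := by
    unfold numKR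
    exact_mod_cast Nat.choose_le_choose K (Nat.sub_le P K)
  have h0 : (0:ℝ) ≤ ((P - K).choose K : ℝ) := Nat.cast_nonneg _
  constructor
  · by_contra hq
    nlinarith
  · by_contra hq
    nlinarith

/-- Theorem 1 (very strong one-law for absence of isolated nodes):
if `α_n (1 - q(θ_n)) = (log n + γ_n)/n` and `γ_n → ∞`, then
`P_n(θ_n, α_n) → 1`. -/
theorem veryStrongOneLaw
    (K P : ℕ → ℕ) (α γ : ℕ → ℝ)
    (hK : ∀ n, 0 < K n) (hKP : ∀ n, K n < P n)
    (hα : ∀ n, 0 ≤ α n ∧ α n ≤ 1)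
    (hscal : ∀ n, 1 ≤ n → α n * (1 - q (K n) (P n)) = (Real.log n + γ n) / n)
    (hγ : Tendsto γ atTop atTop) :
    Tendsto (fun n => probNoIsolated n (P n) (K n) (α n)) atTop (nhds 1) := by
  have hlow : Tendsto (fun n => 1 - Real.exp (1 - γ n)) atTop (nhds 1) := by
    have h1 : Tendsto (fun n => 1 - γ n) atTop atBot := by
      simpa [sub_eq_add_neg] using
        tendsto_atBot_add_const_left atTop (1:ℝ) (tendsto_neg_atTop_atBot.comp hγ)
    have h2 := Real.tendsto_exp_atBot.comp h1
    simpa using h2.const_sub 1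
  refine tendsto_of_tendsto_of_tendsto_of_le_of_le' hlow tendsto_const_nhds ?_ ?_
  · filter_upwards [eventually_ge_atTop 1] with n hn
    refine le_trans ?_ (aux_ge n (P n) (K n) (hKP n) (α n) (hα n).1 (hα n).2)
    have hq := aux_q_le (P n) (K n) (hKP n)
    set p := α n * (1 - q (K n) (P n)) with hp
    have hp1 : p ≤ 1 := by
      have := mul_le_mul (hα n).2 (show 1 - q (K n) (P n) ≤ 1 by linarith [hq.1])
        (by linarith [hq.2]) zero_le_one
      linarith
    have hn0 : (0:ℝ) < n := by exact_mod_cast hn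
    have hpn : p * n = Real.log n + γ n := by
      rw [hp, hscal n hn]; field_simp
    have h3 : (1 - p) ^ (n - 1) ≤ Real.exp (-p * ((n - 1 : ℕ) : ℝ)) := by
      rw [mul_comm, Real.exp_nat_mul]
      exact pow_le_pow_left₀ (by linarith) (Real.one_sub_le_exp_neg p) _
    have h4 : -p * ((n - 1 : ℕ) : ℝ) ≤ 1 - γ n - Real.log n := by
      rw [Nat.cast_sub hn]; push_cast; nlinarith
    have h5 : (n:ℝ) * (1 - p) ^ (n - 1) ≤ Real.exp (1 - γ n) := by
      calc (n:ℝ) * (1 - p) ^ (n - 1) ≤ n * Real.exp (1 - γ n - Real.log n) :=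
            mul_le_mul_of_nonneg_left (h3.trans (Real.exp_le_exp.2 h4)) hn0.le
        _ = Real.exp (1 - γ n) := by
            rw [Real.exp_sub _ (Real.log n), Real.exp_log hn0]; field_simp
    linarith
  · exact Eventually.of_forall fun n =>
      aux_le_one n (P n) (K n) (hKP n) (α n) (hα n).1 (hα n).2
end

section
/- Fix α in (0,1] and positive integers K and P with K < P such that α(1 − q(θ)) > 0, where θ = (K,P). Then lim_{n→∞} P_n(θ, α) = 1: the probability that the random graph K∩G(n; θ, α) with these fixed parameters contains no isolated nodes tends to one as n → ∞. -/
open Filter Finset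

/-- Sum over all link configurations of a product of local terms. -/
lemma sum_bool_prod (n : ℕ) (f : Pairs n → Bool → ℝ) :
    ∑ b : Pairs n → Bool, ∏ e, f e (b e) = ∏ e, (f e true + f e false) := by
  have h := Finset.prod_univ_sum (fun _ : Pairs n => (Finset.univ : Finset Bool)) f
  rw [Fintype.piFinset_univ] at h
  rw [← h]
  simp

lemma sum_ring_prod (n P K : ℕ) (f : Fin n → KeyRing P K → ℝ) :
    ∑ κ : Fin n → KeyRing P K, ∏ j, f j (κ j) = ∏ j, ∑ T, f j T := by
  have h := Finset.prod_univ_sum (fun _ : Fin n => (Finset.univ : Finset (KeyRing P K))) f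
  rw [Fintype.piFinset_univ] at h
  rw [← h]

lemma card_ring (P K : ℕ) : Fintype.card (KeyRing P K) = P.choose K := by
  have := Fintype.card_finset_len (α := Fin P) K
  simpa using this

lemma wt_nonneg (n P K : ℕ) (α : ℝ) (h0 : 0 < α) (h1 : α ≤ 1)
    (κ : Fin n → KeyRing P K) (b : Pairs n → Bool) : 0 ≤ wt n P K α κ b := by
  unfold wt numKR
  refine mul_nonneg (by positivity) (Finset.prod_nonneg ?_)
  intro e _
  split_ifs <;> linarith

lemma sum_wt (n P K : ℕ) (α : ℝ) (hKP : K < P) :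
    ∑ κ : Fin n → KeyRing P K, ∑ b : Pairs n → Bool, wt n P K α κ b = 1 := by
  have hN : (0:ℝ) < (P.choose K : ℝ) := by exact_mod_cast Nat.choose_pos hKP.le
  unfold wt numKR
  simp_rw [← Finset.mul_sum]
  have h := sum_bool_prod n (fun _ x => if x then α else 1 - α)
  simp only at h
  rw [h]
  simp only [if_true, Bool.false_eq_true, if_false, add_sub_cancel, Finset.prod_const_one, mul_one,
    Finset.sum_const, Finset.card_univ, Fintype.card_fun, card_ring, Fintype.card_fin, nsmul_eq_mul]
  push_cast
  rw [← mul_pow, inv_mul_cancel₀ hN.ne', one_pow]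

/-- The pair formed by `i` and `j`. -/
def mkPair {n : ℕ} (i j : Fin n) (h : j ≠ i) : Pairs n :=
  if h' : i < j then ⟨(i, j), h'⟩ else ⟨(j, i), lt_of_le_of_ne (not_lt.mp h') h⟩

/-- Incident to `i` with equal rings. -/
def Bad {n P K : ℕ} (κ : Fin n → KeyRing P K) (i : Fin n) (e : Pairs n) : Prop :=
  ∃ j, ∃ h : j ≠ i, κ j = κ i ∧ e = mkPair i j h

lemma mkPair_inj {n : ℕ} (i j j' : Fin n) (h : j ≠ i) (h' : j' ≠ i)
    (he : mkPair i j h = mkPair i j' h') : j = j' := by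
  unfold mkPair at he
  split_ifs at he <;> simp_all [Subtype.ext_iff, Prod.ext_iff]

lemma isolated_bad {n P K : ℕ} (hK : 0 < K) (κ : Fin n → KeyRing P K) (b : Pairs n → Bool)
    (i : Fin n) (hi : Isolated κ b i) (e : Pairs n) (he : Bad κ i e) : b e = false := by
  obtain ⟨j, hj, hκ, rfl⟩ := he
  have h := hi j
  have hne : ((κ i).1 ∩ (κ j).1).Nonempty := by
    rw [hκ, Finset.inter_self, ← Finset.card_pos, (κ i).2]
    exact hK
  by_contra hb
  refine h ⟨hj.symm, hne, ?_⟩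
  have hb' : b (mkPair i j hj) = true := by simpa using hb
  unfold mkPair at hb'
  unfold link
  by_cases h1 : i < j
  · simpa [h1] using hb'
  · have h2 : j < i := lt_of_le_of_ne (not_lt.mp h1) hj
    simpa [h1, h2] using hb'

open Classical in
lemma sum_b_isolated (n P K : ℕ) (α : ℝ) (hK : 0 < K) (h0 : 0 < α) (h1 : α ≤ 1)
    (κ : Fin n → KeyRing P K) (i : Fin n) :
    ∑ b : Pairs n → Bool, (∏ e : Pairs n, (if b e then α else 1 - α)) *
      (if Isolated κ b i then 1 else 0) ≤
    ∏ j, (if j ≠ i ∧ κ j = κ i then 1 - α else 1) := by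
  calc _ ≤ ∑ b : Pairs n → Bool, ∏ e : Pairs n,
        ((if b e then α else 1 - α) * (if Bad κ i e ∧ b e = true then 0 else 1)) := by
        refine Finset.sum_le_sum fun b _ => ?_
        split_ifs with hb
        · rw [mul_one]
          refine le_of_eq (Finset.prod_congr rfl fun e _ => ?_)
          rw [if_neg (c := Bad κ i e ∧ b e = true), mul_one]
          rintro ⟨h2, h3⟩
          rw [isolated_bad hK κ b i hb e h2] at h3
          exact absurd h3 (by simp)
        · rw [mul_zero]
          refine Finset.prod_nonneg fun e _ => mul_nonneg ?_ ?_
          · split_ifs <;> linarith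
          · split_ifs <;> simp
    _ = ∏ e : Pairs n, (if Bad κ i e then 1 - α else 1) := by
        have h := sum_bool_prod n (fun e x => (if x then α else 1 - α) *
          (if Bad κ i e ∧ x = true then 0 else 1))
        simp only at h
        rw [h]
        refine Finset.prod_congr rfl fun e _ => ?_
        by_cases hB : Bad κ i e <;> simp [hB]
    _ ≤ _ := by
        have e1 : ∏ e : Pairs n, (if Bad κ i e then 1 - α else 1) =
            (1 - α) ^ (Finset.univ.filter fun e : Pairs n => Bad κ i e).card := by
          rw [Finset.prod_ite, Finset.prod_const, Finset.prod_const_one, mul_one]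
        have e2 : ∏ j, (if j ≠ i ∧ κ j = κ i then 1 - α else 1) =
            (1 - α) ^ (Finset.univ.filter fun j => j ≠ i ∧ κ j = κ i).card := by
          rw [Finset.prod_ite, Finset.prod_const, Finset.prod_const_one, mul_one]
        rw [e1, e2]
        refine pow_le_pow_of_le_one (by linarith) (by linarith) ?_
        refine Finset.card_le_card_of_forall_subsingleton
          (fun j e => ∃ h : j ≠ i, e = mkPair i j h) ?_ ?_
        · intro j hj
          simp only [Finset.mem_filter, Finset.mem_univ, true_and] at hj
          refine ⟨mkPair i j hj.1, ?_, hj.1, rfl⟩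
          simp only [Finset.mem_filter, Finset.mem_univ, true_and]
          exact ⟨j, hj.1, hj.2, rfl⟩
        · rintro e _ j ⟨_, hj, rfl⟩ j' ⟨_, hj', he⟩
          exact mkPair_inj i j j' hj hj' he

lemma prob_isolated (n P K : ℕ) (α : ℝ) (hK : 0 < K) (hKP : K < P) (h0 : 0 < α) (h1 : α ≤ 1)
    (i : Fin n) :
    ∑ κ : Fin n → KeyRing P K, ∑ b : Pairs n → Bool,
      wt n P K α κ b * (if Isolated κ b i then 1 else 0) ≤
    (P.choose K : ℝ) * (1 - α / (P.choose K : ℝ)) ^ (n - 1) := by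
  classical
  set N : ℝ := (P.choose K : ℝ) with hNdef
  have hN : (0:ℝ) < N := by rw [hNdef]; exact_mod_cast Nat.choose_pos hKP.le
  have hn : n = (n - 1) + 1 := by have := i.pos; omega
  calc _ ≤ ∑ κ : Fin n → KeyRing P K,
        N⁻¹ ^ n * ∏ j, (if j ≠ i ∧ κ j = κ i then 1 - α else 1) := by
        refine Finset.sum_le_sum fun κ _ => ?_
        unfold wt numKR
        simp_rw [mul_assoc]
        rw [← Finset.mul_sum]
        refine mul_le_mul_of_nonneg_left ?_ (by positivity)
        convert sum_b_isolated n P K α hK h0 h1 κ i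
    _ ≤ ∑ κ : Fin n → KeyRing P K, ∑ S : KeyRing P K,
        N⁻¹ ^ n * ∏ j, (if j ≠ i ∧ κ j = S then 1 - α else 1) := by
        refine Finset.sum_le_sum fun κ _ => ?_
        refine Finset.single_le_sum (f := fun S : KeyRing P K =>
          N⁻¹ ^ n * ∏ j, (if j ≠ i ∧ κ j = S then 1 - α else 1)) ?_ (Finset.mem_univ (κ i))
        intro S _
        refine mul_nonneg (by positivity) (Finset.prod_nonneg fun j _ => ?_)
        split_ifs <;> linarith
    _ = ∑ S : KeyRing P K, N⁻¹ ^ n * ∏ j : Fin n, ∑ T : KeyRing P K,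
          (if j ≠ i ∧ T = S then 1 - α else 1) := by
        rw [Finset.sum_comm]
        refine Finset.sum_congr rfl fun S _ => ?_
        rw [← Finset.mul_sum, ← sum_ring_prod n P K
          (fun j T => if j ≠ i ∧ T = S then 1 - α else 1)]
    _ = ∑ S : KeyRing P K, (1 - α / N) ^ (n - 1) := by
        refine Finset.sum_congr rfl fun S _ => ?_
        have hS : ∀ j : Fin n, ∑ T : KeyRing P K, (if j ≠ i ∧ T = S then 1 - α else 1)
            = if j = i then N else N - α := by
          intro j
          have hc : ∑ T : KeyRing P K, (1:ℝ) = N := by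
            simp only [Finset.sum_const, Finset.card_univ, card_ring, nsmul_eq_mul, mul_one, hNdef]
          by_cases hj : j = i
          · simp only [hj, ne_eq, not_true_eq_false, false_and, if_false, if_true]
            exact hc
          · have : ∀ T : KeyRing P K, (if j ≠ i ∧ T = S then 1 - α else 1)
                = 1 - (if T = S then α else 0) := by
              intro T
              by_cases hT : T = S <;> simp [hj, hT]
            simp_rw [this]
            rw [Finset.sum_sub_distrib, hc]
            simp [hj]
        simp_rw [hS]
        rw [← Finset.mul_prod_erase _ _ (Finset.mem_univ i)]
        have : ∏ x ∈ Finset.univ.erase i, (if x = i then N else N - α) = (N - α) ^ (n - 1) := by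
          rw [Finset.prod_congr rfl (g := fun _ => N - α)]
          · simp
          · intro x hx
            simp [Finset.ne_of_mem_erase hx]
        rw [this, if_pos rfl]
        have h3 : 1 - α / N = N⁻¹ * (N - α) := by field_simp
        rw [h3, mul_pow]
        conv_lhs => rw [hn]
        simp only [Nat.add_sub_cancel]
        rw [pow_succ]
        field_simp
    _ = _ := by
        simp only [Finset.sum_const, Finset.card_univ, card_ring, nsmul_eq_mul, hNdef]

lemma prob_lower (n P K : ℕ) (α : ℝ) (hK : 0 < K) (hKP : K < P) (h0 : 0 < α) (h1 : α ≤ 1) :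
    1 - n * ((P.choose K : ℝ) * (1 - α / (P.choose K : ℝ)) ^ (n - 1)) ≤
      probNoIsolated n P K α := by
  have h2 : ∑ i : Fin n, ∑ κ : Fin n → KeyRing P K, ∑ b : Pairs n → Bool,
      wt n P K α κ b * (if Isolated κ b i then 1 else 0) ≤
      n * ((P.choose K : ℝ) * (1 - α / (P.choose K : ℝ)) ^ (n - 1)) := by
    refine (Finset.sum_le_sum fun i _ => prob_isolated n P K α hK hKP h0 h1 i).trans ?_
    simp
  have h3 : (1:ℝ) ≤ probNoIsolated n P K α + ∑ i : Fin n, ∑ κ : Fin n → KeyRing P K,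
      ∑ b : Pairs n → Bool, wt n P K α κ b * (if Isolated κ b i then 1 else 0) := by
    refine (sum_wt n P K α hKP).symm.le.trans ?_
    rw [Finset.sum_comm (s := (Finset.univ : Finset (Fin n)))]
    unfold probNoIsolated
    rw [← Finset.sum_add_distrib]
    refine Finset.sum_le_sum fun κ _ => ?_
    rw [Finset.sum_comm (s := (Finset.univ : Finset (Fin n))), ← Finset.sum_add_distrib]
    refine Finset.sum_le_sum fun b _ => ?_
    rw [← Finset.mul_sum, ← mul_add]
    refine le_mul_of_one_le_right (wt_nonneg n P K α h0 h1 κ b) ?_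
    have hnn : ∀ i ∈ (Finset.univ : Finset (Fin n)),
        (0:ℝ) ≤ (if Isolated κ b i then 1 else 0) := by
      intro i _
      split_ifs <;> simp
    by_cases hall : ∀ i, ¬ Isolated κ b i
    · rw [if_pos hall]
      have := Finset.sum_nonneg hnn
      linarith
    · rw [if_neg hall]
      rw [not_forall] at hall
      obtain ⟨i, hi⟩ := hall
      have := Finset.single_le_sum hnn (Finset.mem_univ i)
      rw [if_pos (not_not.mp hi)] at this
      linarith
  linarith

lemma prob_upper (n P K : ℕ) (α : ℝ) (hKP : K < P) (h0 : 0 < α) (h1 : α ≤ 1) :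
    probNoIsolated n P K α ≤ 1 := by
  rw [← sum_wt n P K α hKP]
  unfold probNoIsolated
  refine Finset.sum_le_sum fun κ _ => Finset.sum_le_sum fun b _ => ?_
  refine mul_le_of_le_one_right (wt_nonneg n P K α h0 h1 κ b) ?_
  split_ifs <;> simp

/-- Corollary: for fixed parameters `θ = (K,P)` with `K < P` and fixed `α ∈ (0,1]`
with `α(1 - q(θ)) > 0`, the probability that `K ∩ G(n; θ, α)` contains no isolated
nodes tends to one as `n → ∞`. -/
theorem fixedParameters_oneLaw
    (K P : ℕ) (α : ℝ)
    (hK : 0 < K) (hKP : K < P)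
    (hα0 : 0 < α) (hα1 : α ≤ 1)
    (hpos : 0 < α * (1 - q K P)) :
    Tendsto (fun n => probNoIsolated n P K α) atTop (nhds 1) := by
  have hN1 : (1:ℝ) ≤ (P.choose K : ℝ) := by exact_mod_cast Nat.choose_pos hKP.le
  have hρ0 : 0 ≤ 1 - α / (P.choose K : ℝ) := by
    have : α / (P.choose K : ℝ) ≤ 1 := by
      rw [div_le_one (by linarith)]
      linarith
    linarith
  have hρ1 : 1 - α / (P.choose K : ℝ) < 1 := by
    have : 0 < α / (P.choose K : ℝ) := by positivity
    linarith
  refine tendsto_of_tendsto_of_tendsto_of_le_of_le ?_ tendsto_const_nhds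
    (fun n => prob_lower n P K α hK hKP hα0 hα1) (fun n => prob_upper n P K α hKP hα0 hα1)
  generalize (1 - α / (P.choose K : ℝ)) = ρ at *
  generalize (P.choose K : ℝ) = N at *
  rw [← tendsto_add_atTop_iff_nat 1]
  have ha := tendsto_self_mul_const_pow_of_lt_one hρ0 hρ1
  have hb := tendsto_pow_atTop_nhds_zero_of_lt_one hρ0 hρ1
  have hc := ((ha.add hb).const_mul N).const_sub 1
  simp only [add_zero, mul_zero, sub_zero] at hc
  refine hc.congr fun n => ?_
  simp only [Nat.add_sub_cancel]
  push_cast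
  ring
end

section
/- Let (p_n) be a sequence of reals with 0 ≤ p_n ≤ 1 and p_n = (log n + γ_n)/n for all n ≥ 2, for some real sequence γ_n. Then lim_{n→∞} n(1 − p_n)^{n−1} = 0 whenever lim_{n→∞} γ_n = ∞, and lim_{n→∞} n(1 − p_n)^{n−1} = ∞ whenever lim_{n→∞} γ_n = −∞. -/
open Filter

/-- If `0 ≤ p_n ≤ 1` and `p_n = (log n + γ_n)/n` for `n ≥ 2`, then
`n (1 - p_n)^{n-1} → 0` whenever `γ_n → ∞`, and `n (1 - p_n)^{n-1} → ∞`
whenever `γ_n → -∞`. -/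
theorem expected_isolated_asymptotics
    (p γ : ℕ → ℝ)
    (hp : ∀ n, 2 ≤ n → 0 ≤ p n ∧ p n ≤ 1)
    (heq : ∀ n, 2 ≤ n → p n = (Real.log n + γ n) / n) :
    (Tendsto γ atTop atTop →
      Tendsto (fun n : ℕ => (n : ℝ) * (1 - p n) ^ (n - 1)) atTop (nhds 0)) ∧
    (Tendsto γ atTop atBot →
      Tendsto (fun n : ℕ => (n : ℝ) * (1 - p n) ^ (n - 1)) atTop atTop) := by
  constructor
  · intro h
    have hlim : Tendsto (fun n : ℕ => Real.exp (1 + -γ n)) atTop (nhds 0) :=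
      Real.tendsto_exp_atBot.comp
        (tendsto_atBot_add_const_left _ 1 (tendsto_neg_atTop_atBot.comp h))
    refine squeeze_zero' ?_ ?_ hlim
    · filter_upwards [eventually_ge_atTop 2] with n hn
      have := hp n hn
      have : 0 ≤ 1 - p n := by linarith
      positivity
    · filter_upwards [eventually_ge_atTop 2] with n hn
      obtain ⟨h0, h1⟩ := hp n hn
      have hnpos : (0 : ℝ) < n := by
        have : 0 < n := by omega
        exact_mod_cast this
      have hnp : (n : ℝ) * p n = Real.log n + γ n := by
        rw [heq n hn]; field_simp
      have hb : 1 - p n ≤ Real.exp (-p n) := by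
        have := Real.add_one_le_exp (-p n); linarith
      have hpow : (1 - p n) ^ (n - 1) ≤ Real.exp (((n - 1 : ℕ) : ℝ) * (-p n)) := by
        rw [Real.exp_nat_mul]
        exact pow_le_pow_left₀ (by linarith) hb _
      have hc : ((n - 1 : ℕ) : ℝ) = n - 1 := by
        rw [Nat.cast_sub (by omega)]; simp
      rw [hc] at hpow
      calc (n : ℝ) * (1 - p n) ^ (n - 1)
          ≤ n * Real.exp (((n : ℝ) - 1) * (-p n)) := by gcongr
        _ = Real.exp (Real.log n + ((n : ℝ) - 1) * (-p n)) := by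
            rw [Real.exp_add, Real.exp_log hnpos]
        _ ≤ Real.exp (1 + -γ n) := by
            apply Real.exp_le_exp.mpr
            nlinarith
  · intro h
    have hlim : Tendsto (fun n : ℕ => Real.exp (-8 + -γ n)) atTop atTop :=
      Real.tendsto_exp_atTop.comp
        (tendsto_atTop_add_const_left _ (-8) (tendsto_neg_atBot_atTop.comp h))
    refine tendsto_atTop_mono' _ ?_ hlim
    filter_upwards [eventually_ge_atTop 16, h.eventually_le_atBot 0] with n hn hγ
    obtain ⟨h0, h1⟩ := hp n (by omega)
    have hn16 : (16 : ℝ) ≤ n := by exact_mod_cast hn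
    have hnpos : (0 : ℝ) < n := by linarith
    have hnp : (n : ℝ) * p n = Real.log n + γ n := by
      rw [heq n (by omega)]; field_simp
    have hs : Real.sqrt n * Real.sqrt n = n := Real.mul_self_sqrt hnpos.le
    have hs4 : 4 ≤ Real.sqrt n := Real.le_sqrt_of_sq_le (by linarith)
    have hlog : Real.log n ≤ 2 * Real.sqrt n := by
      have h1 := Real.log_sqrt hnpos.le
      have h2 := Real.log_le_sub_one_of_pos (Real.sqrt_pos.mpr hnpos)
      linarith
    have hnp2 : (n : ℝ) * p n ≤ 2 * Real.sqrt n := by linarith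
    have hsp : Real.sqrt n * p n ≤ 2 := by
      have : Real.sqrt n * (Real.sqrt n * p n) ≤ Real.sqrt n * 2 := by
        rw [← mul_assoc, hs]; linarith
      exact le_of_mul_le_mul_left this (by linarith)
    have hhalf : p n ≤ 1 / 2 := by nlinarith
    have hnpp : (n : ℝ) * p n * p n ≤ 4 := by
      have h0' : 0 ≤ Real.sqrt n * p n := by positivity
      calc (n : ℝ) * p n * p n = (Real.sqrt n * p n) * (Real.sqrt n * p n) := by
            nth_rewrite 1 [← hs]; ring
        _ ≤ 2 * 2 := mul_le_mul hsp hsp h0' (by norm_num)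
        _ = 4 := by norm_num
    have hq : 0 < 1 - p n := by linarith
    have hb : Real.exp (-(p n / (1 - p n))) ≤ 1 - p n := by
      rw [Real.exp_neg]
      apply inv_le_of_inv_le₀ hq
      have := Real.add_one_le_exp (p n / (1 - p n))
      have e : (1 - p n)⁻¹ = p n / (1 - p n) + 1 := by field_simp; ring
      rw [e]; exact this
    have hpow : Real.exp (((n - 1 : ℕ) : ℝ) * (-(p n / (1 - p n)))) ≤ (1 - p n) ^ (n - 1) := by
      rw [Real.exp_nat_mul]
      exact pow_le_pow_left₀ (Real.exp_pos _).le hb _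
    have hc : ((n - 1 : ℕ) : ℝ) = n - 1 := by
      rw [Nat.cast_sub (by omega)]; simp
    rw [hc] at hpow
    have key : ((n : ℝ) - 1) * (p n / (1 - p n)) ≤ n * p n + 8 := by
      rw [← mul_div_assoc, div_le_iff₀ hq]
      nlinarith
    calc Real.exp (-8 + -γ n)
        ≤ Real.exp (Real.log n + ((n : ℝ) - 1) * (-(p n / (1 - p n)))) := by
          apply Real.exp_le_exp.mpr
          linarith
      _ = n * Real.exp (((n : ℝ) - 1) * (-(p n / (1 - p n)))) := by
          rw [Real.exp_add, Real.exp_log hnpos]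
      _ ≤ (n : ℝ) * (1 - p n) ^ (n - 1) := by gcongr
end
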